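/- arXiv:2603.01244 — 2 statements merged into one kernel-verified Lean document; each statement's English description precedes it below -/
import Mathlib

section
/- Let A = ⟨a_1,…,a_{3m}⟩ be a sequence of positive integers and B a positive integer with B/4 < a_i < B/2 for all i and Σ a_i = mB, and let (G, S, t) be the derived Hexasort instance on m disjoint gadget copies with t = B+4. Then S is emptyable on (G, t) if and only if the index set {1,…,3m} can be partitioned into m triples each of whose corresponding values a_i sum to exactly B. -/
open scoped Classical

namespace Hexasort

/-- A board configuration: each vertex holds either a stack `(color, height)` or nothing. -/
abbrev Config (V C : Type*) := V → Option (C × ℕ)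

/-- The everywhere-empty configuration. -/
def emptyConfig (V C : Type*) : Config V C := fun _ => none

/-- The height contributed by a board entry to color `c` (0 if empty or another color). -/
noncomputable def colorHeight {C : Type*} (e : Option (C × ℕ)) (c : C) : ℕ :=
  match e with
  | none => 0
  | some (c', h) => if c' = c then h else 0

/-- Total height of the color-`c` stacks on the neighbors of `x`. -/
noncomputable def neighborSum {V C : Type*} [Fintype V] (G : SimpleGraph V)
    (δ : Config V C) (c : C) (x : V) : ℕ :=
  ∑ y ∈ Finset.univ.filter (fun y => G.Adj x y), colorHeight (δ y) c

/-- The configuration resulting from placing the stack `s` on the vertex `x`: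
all same-colored neighbors are emptied, and `x` gets the merged stack unless
its total height reaches the threshold `t`, in which case `x` becomes empty. -/
noncomputable def place {V C : Type*} [Fintype V] (G : SimpleGraph V) (t : ℕ)
    (δ : Config V C) (s : C × ℕ) (x : V) : Config V C :=
  fun v =>
    if v = x then
      (if t ≤ s.2 + neighborSum G δ s.1 x then none
       else some (s.1, s.2 + neighborSum G δ s.1 x))
    else if G.Adj x v ∧ (∃ hh, δ v = some (s.1, hh)) then none
    else δ v

/-- Play a sequence of stacks on a sequence of vertices, starting from `δ`. -/
noncomputable def play {V C : Type*} [Fintype V] (G : SimpleGraph V) (t : ℕ) :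
    Config V C → List (C × ℕ) → List V → Config V C
  | δ, [], _ => δ
  | δ, _ :: _, [] => δ
  | δ, s :: S, x :: p => play G t (place G t δ s x) S p

/-- Legality of playing the stacks `S` on the vertices `p`, starting from `δ`:
each stack is placed on a vertex that is empty at that moment. -/
inductive Legal {V C : Type*} [Fintype V] (G : SimpleGraph V) (t : ℕ) :
    Config V C → List (C × ℕ) → List V → Prop
  | nil (δ : Config V C) : Legal G t δ [] []
  | cons {δ : Config V C} (s : C × ℕ) (S : List (C × ℕ)) (x : V) (p : List V) :
      δ x = none → Legal G t (place G t δ s x) S p →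
      Legal G t δ (s :: S) (x :: p)

/-- `S` is fittable on `(G, t)`: all stacks can be placed in order. -/
def Fittable {V C : Type*} [Fintype V] (G : SimpleGraph V) (t : ℕ)
    (S : List (C × ℕ)) : Prop :=
  ∃ p : List V, Legal G t (emptyConfig V C) S p

/-- `S` is emptyable on `(G, t)`: all stacks can be placed in order so that the
final configuration is everywhere empty. -/
def Emptyable {V C : Type*} [Fintype V] (G : SimpleGraph V) (t : ℕ)
    (S : List (C × ℕ)) : Prop :=
  ∃ p : List V, Legal G t (emptyConfig V C) S p ∧
    play G t (emptyConfig V C) S p = emptyConfig V C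

end Hexasort

namespace Hexasort

/-- The vertices of the ten-vertex gadget graph `H`: a center `x`, a leaf `s` adjacent
to the center, and four arms `x – la i – lb i` for `i ∈ {0,1,2,3}`. -/
inductive GadgetV : Type
  | x | s | la : Fin 4 → GadgetV | lb : Fin 4 → GadgetV
  deriving DecidableEq, Fintype

/-- The base (asymmetric) adjacency relation of the gadget graph `H`. -/
def gadgetRel : GadgetV → GadgetV → Prop := fun u v =>
  (u = .x ∧ v = .s) ∨ (∃ i, u = .x ∧ v = .la i) ∨ (∃ i, u = .la i ∧ v = .lb i)

/-- The disjoint union of `m` copies of the gadget graph `H`. -/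
def disjointGadgets (m : ℕ) : SimpleGraph (Fin m × GadgetV) :=
  SimpleGraph.fromRel (fun u v => u.1 = v.1 ∧ gadgetRel u.2 v.2)

/-- Colors for the 3-Partition reduction: `some (j, 0/1/2)` are `red_j`, `blue_j`,
`green_j`, and `none` is the color black. -/
abbrev GColor (m : ℕ) := Option (Fin m × Fin 3)

/-- `S_initial`: for each gadget `j`, two stacks of height `t−1` of each of the three
gadget colors `red_j, blue_j, green_j`. -/
def SinitialG (m t : ℕ) : List (GColor m × ℕ) :=
  (List.finRange m).flatMap (fun j =>
    [(some (j, 0), t-1), (some (j, 0), t-1), (some (j, 1), t-1),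
     (some (j, 1), t-1), (some (j, 2), t-1), (some (j, 2), t-1)])

/-- `S_A`: the black stacks encoding the 3-Partition input values. -/
def SAG (m : ℕ) (a : Fin (3*m) → ℕ) : List (GColor m × ℕ) :=
  (List.finRange (3*m)).map (fun i => ((none : GColor m), a i))

/-- `S_connector`: for each gadget `j`, one stack of height `t−1` of each gadget color. -/
def SconnectorG (m t : ℕ) : List (GColor m × ℕ) :=
  (List.finRange m).flatMap (fun j =>
    [(some (j, 0), t-1), (some (j, 1), t-1), (some (j, 2), t-1)])

/-- `S_final`: for each gadget, four black stacks of height `1`. -/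
def SfinalG (m : ℕ) : List (GColor m × ℕ) :=
  (List.finRange m).flatMap (fun _ =>
    [((none : GColor m), 1), (none, 1), (none, 1), (none, 1)])

/-- The full stack sequence `S = S_initial + S_A + S_connector + S_final`. -/
def SfullG (m : ℕ) (a : Fin (3*m) → ℕ) (t : ℕ) : List (GColor m × ℕ) :=
  SinitialG m t ++ SAG m a ++ SconnectorG m t ++ SfinalG m

end Hexasort

set_option linter.constructorNameAsVariable false
namespace Hexasort

def Reach {V C : Type*} [Fintype V] (G : SimpleGraph V) (t : ℕ)
    (δ : Config V C) (S : List (C × ℕ)) (δ' : Config V C) : Prop :=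
  ∃ p : List V, Legal G t δ S p ∧ play G t δ S p = δ'

theorem Reach.nil {V C : Type*} [Fintype V] {G : SimpleGraph V} {t : ℕ} (δ : Config V C) :
    Reach G t δ [] δ := ⟨[], .nil _, rfl⟩

theorem Reach.cons {V C : Type*} [Fintype V] {G : SimpleGraph V} {t : ℕ} {δ δ' δ'' : Config V C}
    {s : C × ℕ} {S : List (C × ℕ)} (x : V) (hx : δ x = none) (hp : place G t δ s x = δ')
    (h : Reach G t δ' S δ'') : Reach G t δ (s :: S) δ'' := by
  obtain ⟨p, h1, h2⟩ := h
  subst hp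
  exact ⟨x :: p, .cons _ _ _ _ hx h1, h2⟩

theorem Reach.append {V C : Type*} [Fintype V] {G : SimpleGraph V} {t : ℕ} {δ δ' δ'' : Config V C}
    {S T : List (C × ℕ)} (h : Reach G t δ S δ') (h' : Reach G t δ' T δ'') :
    Reach G t δ (S ++ T) δ'' := by
  obtain ⟨p, h1, h2⟩ := h
  induction h1 with
  | nil δ => simp only [play] at h2; subst h2; exact h'
  | cons s S x p hx _ ih => exact Reach.cons x hx rfl (ih h2)

abbrev HG : SimpleGraph GadgetV := SimpleGraph.fromRel gadgetRel

@[simp] theorem hadj_xx : ¬ HG.Adj .x .x := by simp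
@[simp] theorem hadj_xs : HG.Adj .x .s := by simp [gadgetRel]
@[simp] theorem hadj_xla (i) : HG.Adj .x (.la i) := by simp [gadgetRel]
@[simp] theorem hadj_xlb (i) : ¬ HG.Adj .x (.lb i) := by simp [gadgetRel]
@[simp] theorem hadj_sx : HG.Adj .s .x := by simp [gadgetRel]
@[simp] theorem hadj_ss : ¬ HG.Adj .s .s := by simp
@[simp] theorem hadj_sla (i) : ¬ HG.Adj .s (.la i) := by simp [gadgetRel]
@[simp] theorem hadj_slb (i) : ¬ HG.Adj .s (.lb i) := by simp [gadgetRel]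
@[simp] theorem hadj_lax (i) : HG.Adj (.la i) .x := by simp [gadgetRel]
@[simp] theorem hadj_las (i) : ¬ HG.Adj (.la i) .s := by simp [gadgetRel]
@[simp] theorem hadj_lala (i k) : ¬ HG.Adj (.la i) (.la k) := by simp [gadgetRel]
@[simp] theorem hadj_lalb (i k) : HG.Adj (.la i) (.lb k) ↔ k = i := by
  simp [gadgetRel]
@[simp] theorem hadj_lbx (i) : ¬ HG.Adj (.lb i) .x := by simp [gadgetRel]
@[simp] theorem hadj_lbs (i) : ¬ HG.Adj (.lb i) .s := by simp [gadgetRel]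
@[simp] theorem hadj_lbla (i k) : HG.Adj (.lb i) (.la k) ↔ k = i := by
  simp [gadgetRel, eq_comm]
@[simp] theorem hadj_lblb (i k) : ¬ HG.Adj (.lb i) (.lb k) := by simp [gadgetRel]

theorem dadj {m : ℕ} (j j' : Fin m) (w u : GadgetV) :
    (disjointGadgets m).Adj (j, w) (j', u) ↔ j = j' ∧ HG.Adj w u := by
  simp only [disjointGadgets, SimpleGraph.fromRel_adj, ne_eq, Prod.mk.injEq]
  constructor
  · rintro ⟨h, ⟨rfl, h2⟩ | ⟨rfl, h2⟩⟩ <;> simp_all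
  · rintro ⟨rfl, h, h2⟩; simp_all

theorem gsum (F : GadgetV → ℕ) : ∑ u, F u = F .x + F .s + ∑ i, F (.la i) + ∑ i, F (.lb i) := by
  have : (Finset.univ : Finset GadgetV) = {.x, .s, .la 0, .la 1, .la 2, .la 3,
    .lb 0, .lb 1, .lb 2, .lb 3} := by decide
  rw [this]
  simp [Finset.sum_insert, Fin.sum_univ_four]
  ring

def lift {m : ℕ} {C : Type*} (δ : Config (Fin m × GadgetV) C) (j : Fin m) (γ : Config GadgetV C) :
    Config (Fin m × GadgetV) C := fun v => if v.1 = j then γ v.2 else δ v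

theorem nsum_lift {m : ℕ} {C : Type*} (δ : Config (Fin m × GadgetV) C) (c : C) (j w) :
    neighborSum (disjointGadgets m) δ c (j, w) = neighborSum HG (fun u => δ (j, u)) c w := by
  unfold neighborSum
  rw [Finset.sum_filter, Finset.sum_filter, Fintype.sum_prod_type, Finset.sum_eq_single j]
  · simp [dadj]
  · intro b _ hb
    apply Finset.sum_eq_zero
    intro u _
    simp [dadj, hb.symm]
  · simp

theorem place_lift {m : ℕ} {C : Type*} (t : ℕ) (δ : Config (Fin m × GadgetV) C) (s : C × ℕ) (j w) :
    place (disjointGadgets m) t δ s (j, w) = lift δ j (place HG t (fun u => δ (j, u)) s w) := by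
  funext ⟨j', u⟩
  simp only [place, lift, nsum_lift, dadj, Prod.mk.injEq]
  by_cases h : j' = j
  · subst h; simp
  · simp [h, Ne.symm h]

theorem Reach.lift {m : ℕ} {C : Type*} {t : ℕ} {γ γ' : Config GadgetV C} {S : List (C × ℕ)}
    (h : Reach HG t γ S γ') (δ : Config (Fin m × GadgetV) C) (j : Fin m)
    (hδ : ∀ u, δ (j, u) = γ u) : Reach (disjointGadgets m) t δ S (lift δ j γ') := by
  obtain ⟨p, h1, h2⟩ := h
  induction h1 generalizing δ with
  | nil γ =>
    simp only [play] at h2; subst h2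
    convert Reach.nil δ using 1
    funext ⟨j', u⟩
    simp only [Hexasort.lift]
    split_ifs with h
    · subst h; rw [hδ]
    · rfl
  | @cons γ s S x p hx _ ih =>
    refine Reach.cons (j, x) (by rw [hδ, hx]) rfl ?_
    have : (fun u => δ (j, u)) = γ := funext hδ
    rw [place_lift, this]
    convert ih (Hexasort.lift δ j (place HG t γ s x)) ?_ h2 using 1
    · funext v; simp only [Hexasort.lift]; split_ifs <;> rfl
    · intro u; simp [Hexasort.lift]

theorem Reach.blocks {m : ℕ} {C : Type*} {t : ℕ} (S : Fin m → List (C × ℕ))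
    (Y X : Fin m → Config GadgetV C) (h : ∀ j, Reach HG t (Y j) (S j) (X j))
    (l : List (Fin m)) (hl : l.Nodup) (δ : Config (Fin m × GadgetV) C)
    (hδ : ∀ j ∈ l, ∀ u, δ (j, u) = Y j u) :
    Reach (disjointGadgets m) t δ (l.flatMap S) (fun v => if v.1 ∈ l then X v.1 v.2 else δ v) := by
  induction l generalizing δ with
  | nil => simpa using Reach.nil δ
  | cons j l ih =>
    rw [List.flatMap_cons]
    have hj : j ∉ l := (List.nodup_cons.1 hl).1
    refine Reach.append ((h j).lift δ j (hδ j (by simp))) ?_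
    convert ih (List.nodup_cons.1 hl).2 (Hexasort.lift δ j (X j)) ?_ using 1
    · funext ⟨j', u⟩
      simp only [Hexasort.lift, List.mem_cons]
      by_cases h1 : j' = j
      · subst h1; simp [hj]
      · simp [h1]
    · intro k hk u
      have : k ≠ j := by rintro rfl; exact hj hk
      simp [Hexasort.lift, this, hδ k (by simp [hk])]

theorem Reach.blocksAll {m : ℕ} {C : Type*} {t : ℕ} (S : Fin m → List (C × ℕ))
    (Y X : Fin m → Config GadgetV C) (h : ∀ j, Reach HG t (Y j) (S j) (X j)) :
    Reach (disjointGadgets m) t (fun v => Y v.1 v.2) ((List.finRange m).flatMap S)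
      (fun v => X v.1 v.2) := by
  have := Reach.blocks S Y X h (List.finRange m) (List.nodup_finRange m) (fun v => Y v.1 v.2)
    (fun _ _ _ => rfl)
  simpa using this

def gc {C : Type*} (X S : Option (C × ℕ)) (a b : Fin 4 → Option (C × ℕ)) : Config GadgetV C
  | .x => X
  | .s => S
  | .la i => a i
  | .lb i => b i

noncomputable def clr {C : Type*} (c : C) (e : Option (C × ℕ)) : Option (C × ℕ) :=
  if ∃ hh, e = some (c, hh) then none else e

noncomputable def mk {C : Type*} (t : ℕ) (c : C) (h : ℕ) : Option (C × ℕ) :=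
  if t ≤ h then none else some (c, h)

theorem place_x {C : Type*} (t : ℕ) (X S : Option (C × ℕ)) (a b : Fin 4 → Option (C × ℕ)) (c : C) (h : ℕ) :
    place HG t (gc X S a b) (c, h) .x =
      gc (mk t c (h + (colorHeight S c + ∑ i, colorHeight (a i) c))) (clr c S)
        (fun i => clr c (a i)) b := by
  funext v
  unfold place neighborSum
  rw [Finset.sum_filter, gsum]
  cases v <;> simp [gc, mk, clr, -SimpleGraph.fromRel_adj]

theorem place_s {C : Type*} (t : ℕ) (X S : Option (C × ℕ)) (a b : Fin 4 → Option (C × ℕ)) (c : C) (h : ℕ) :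
    place HG t (gc X S a b) (c, h) .s =
      gc (clr c X) (mk t c (h + colorHeight X c)) a b := by
  funext v
  unfold place neighborSum
  rw [Finset.sum_filter, gsum]
  cases v <;> simp [gc, mk, clr, -SimpleGraph.fromRel_adj]

theorem place_la {C : Type*} (t : ℕ) (X S : Option (C × ℕ)) (a b : Fin 4 → Option (C × ℕ)) (i) (c : C) (h : ℕ) :
    place HG t (gc X S a b) (c, h) (.la i) =
      gc (clr c X) S (Function.update a i (mk t c (h + (colorHeight X c + colorHeight (b i) c))))
        (Function.update b i (clr c (b i))) := by
  funext v
  unfold place neighborSum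
  rw [Finset.sum_filter, gsum]
  cases v <;> simp [gc, mk, clr, -SimpleGraph.fromRel_adj, Function.update_apply]
  split_ifs <;> simp_all

theorem place_lb {C : Type*} (t : ℕ) (X S : Option (C × ℕ)) (a b : Fin 4 → Option (C × ℕ)) (i) (c : C) (h : ℕ) :
    place HG t (gc X S a b) (c, h) (.lb i) =
      gc X S (Function.update a i (clr c (a i)))
        (Function.update b i (mk t c (h + (colorHeight (a i) c)))) := by
  funext v
  unfold place neighborSum
  rw [Finset.sum_filter, gsum]
  cases v <;> simp [gc, mk, clr, -SimpleGraph.fromRel_adj, Function.update_apply]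
  split_ifs <;> simp_all

end Hexasort
set_option linter.unusedSimpArgs false
set_option linter.unusedVariables false
namespace Hexasort

theorem gc_congr {C : Type*} {X S X' S' : Option (C × ℕ)} {a b a' b' : Fin 4 → Option (C × ℕ)}
    (h1 : X = X') (h2 : S = S')
    (h3 : a 0 = a' 0 ∧ a 1 = a' 1 ∧ a 2 = a' 2 ∧ a 3 = a' 3)
    (h4 : b 0 = b' 0 ∧ b 1 = b' 1 ∧ b 2 = b' 2 ∧ b 3 = b' 3) : gc X S a b = gc X' S' a' b' := by
  have e1 : a = a' := by funext i; fin_cases i <;> simp_all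
  have e2 : b = b' := by funext i; fin_cases i <;> simp_all
  rw [h1, h2, e1, e2]

theorem reach_init {C : Type*} (n : ℕ) (hn : 1 ≤ n) (r b g : C) (hrb : r ≠ b) (hrg : r ≠ g) (hbg : b ≠ g) :
    Reach HG (n+1) (gc none none ![none, none, none, none] ![none, none, none, none])
      [(r, n), (r, n), (b, n), (b, n), (g, n), (g, n)]
      (gc (some (r, n)) (some (b, n)) ![none, some (b, n), some (g, n), some (g, n)]
        ![some (r, n), none, none, none]) := by
  refine Reach.cons (δ' := gc (some (r, n)) none ![none, none, none, none] ![none, none, none, none])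
    .x rfl ?_ ?_
  · rw [place_x]; apply gc_congr <;> simp [mk, clr, colorHeight, Fin.sum_univ_four]
  refine Reach.cons (δ' := gc (some (r, n)) none ![none, none, none, none] ![some (r, n), none, none, none])
    (.lb 0) rfl ?_ ?_
  · rw [place_lb]; apply gc_congr <;> simp [mk, clr, colorHeight, Fin.sum_univ_four]
  refine Reach.cons (δ' := gc (some (r, n)) (some (b, n)) ![none, none, none, none] ![some (r, n), none, none, none])
    (.s) rfl ?_ ?_
  · rw [place_s]; apply gc_congr <;> simp [mk, clr, colorHeight, Fin.sum_univ_four, hrb]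
  refine Reach.cons (δ' := gc (some (r, n)) (some (b, n)) ![none, some (b, n), none, none] ![some (r, n), none, none, none])
    (.la 1) rfl ?_ ?_
  · rw [place_la]; apply gc_congr <;> simp [mk, clr, colorHeight, Fin.sum_univ_four, hrb]
  refine Reach.cons (δ' := gc (some (r, n)) (some (b, n)) ![none, some (b, n), some (g, n), none] ![some (r, n), none, none, none])
    (.la 2) rfl ?_ ?_
  · rw [place_la]; apply gc_congr <;> simp [mk, clr, colorHeight, Fin.sum_univ_four, hrg]
  refine Reach.cons (δ' := gc (some (r, n)) (some (b, n)) ![none, some (b, n), some (g, n), some (g, n)] ![some (r, n), none, none, none])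
    (.la 3) rfl ?_ (Reach.nil _)
  · rw [place_la]; apply gc_congr <;> simp [mk, clr, colorHeight, Fin.sum_univ_four, hrg]

theorem reach_conn {C : Type*} (n : ℕ) (hn : 1 ≤ n) (r b g k : C) (hrb : r ≠ b) (hrg : r ≠ g) (hbg : b ≠ g)
    (p q s : ℕ) :
    Reach HG (n+1) (gc (some (r, n)) (some (b, n)) ![none, some (b, n), some (g, n), some (g, n)]
        ![some (r, n), some (k, p), some (k, q), some (k, s)])
      [(r, n), (b, n), (g, n)]
      (gc none none ![none, none, none, none]
        ![none, some (k, p), some (k, q), some (k, s)]) := by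
  have h2 : n + 1 ≤ n + (n + n) := by omega
  refine Reach.cons (δ' := gc none (some (b, n)) ![none, some (b, n), some (g, n), some (g, n)]
        ![none, some (k, p), some (k, q), some (k, s)])
    (.la 0) rfl ?_ ?_
  · rw [place_la]; apply gc_congr <;> simp [mk, clr, colorHeight, Fin.sum_univ_four]; omega
  refine Reach.cons (δ' := gc none none ![none, none, some (g, n), some (g, n)]
        ![none, some (k, p), some (k, q), some (k, s)])
    (.x) rfl ?_ ?_
  · rw [place_x]; apply gc_congr <;> simp [mk, clr, colorHeight, Fin.sum_univ_four, hbg.symm]; omega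
  refine Reach.cons (δ' := gc none none ![none, none, none, none]
        ![none, some (k, p), some (k, q), some (k, s)])
    (.x) rfl ?_ (Reach.nil _)
  · rw [place_x]; apply gc_congr <;> simp [mk, clr, colorHeight, Fin.sum_univ_four]; omega

theorem reach_final {C : Type*} (B : ℕ) (k : C) (p q s : ℕ) (h : p + q + s = B) :
    Reach HG (B+4) (gc none none ![none, none, none, none]
        ![none, some (k, p), some (k, q), some (k, s)])
      [(k, 1), (k, 1), (k, 1), (k, 1)]
      (gc none none ![none, none, none, none] ![none, none, none, none]) := by
  refine Reach.cons (δ' := gc none none ![none, some (k, 1 + p), none, none]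
        ![none, none, some (k, q), some (k, s)])
    (.la 1) rfl ?_ ?_
  · rw [place_la]; apply gc_congr <;> simp [mk, clr, colorHeight, Fin.sum_univ_four]; omega
  refine Reach.cons (δ' := gc none none ![none, some (k, 1 + p), some (k, 1 + q), none]
        ![none, none, none, some (k, s)])
    (.la 2) rfl ?_ ?_
  · rw [place_la]; apply gc_congr <;> simp [mk, clr, colorHeight, Fin.sum_univ_four]; omega
  refine Reach.cons (δ' := gc none none ![none, some (k, 1 + p), some (k, 1 + q), some (k, 1 + s)]
        ![none, none, none, none])
    (.la 3) rfl ?_ ?_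
  · rw [place_la]; apply gc_congr <;> simp [mk, clr, colorHeight, Fin.sum_univ_four]; omega
  refine Reach.cons (δ' := gc none none ![none, none, none, none]
        ![none, none, none, none])
    (.x) rfl ?_ (Reach.nil _)
  · rw [place_x]; apply gc_congr <;> simp [mk, clr, colorHeight, Fin.sum_univ_four]; omega

theorem reach_slots {V C ι : Type*} [Fintype V] (G : SimpleGraph V) (t : ℕ) (k : C) (a : ι → ℕ)
    (slot : ι → V) (hinj : Function.Injective slot) (hind : ∀ i i', ¬ G.Adj (slot i) (slot i'))
    (hat : ∀ i, a i < t) (l : List ι) (hl : l.Nodup) (δ : Config V C)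
    (hδ : ∀ i ∈ l, δ (slot i) = none)
    (hadj : ∀ i v, G.Adj (slot i) v → ∀ h, δ v ≠ some (k, h)) :
    ∃ δ', Reach G t δ (l.map fun i => (k, a i)) δ' ∧ (∀ i ∈ l, δ' (slot i) = some (k, a i)) ∧
      ∀ v, (∀ i ∈ l, slot i ≠ v) → δ' v = δ v := by
  induction l generalizing δ with
  | nil => exact ⟨δ, Reach.nil δ, by simp, by simp⟩
  | cons i l ih =>
    have hi : i ∉ l := (List.nodup_cons.1 hl).1
    have hns : neighborSum G δ k (slot i) = 0 := by
      apply Finset.sum_eq_zero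
      intro y hy
      simp only [Finset.mem_filter, Finset.mem_univ, true_and] at hy
      rcases hc : δ y with _ | ⟨c, h⟩
      · rfl
      · have := hadj i y hy h
        simp only [colorHeight]
        rw [if_neg]
        rintro rfl
        exact this hc
    have hp : ∀ v, place G t δ (k, a i) (slot i) v = if v = slot i then some (k, a i) else δ v := by
      intro v
      simp only [place, hns]
      by_cases h1 : v = slot i
      · simp [h1, hat i]
      · rw [if_neg h1, if_neg h1, if_neg]
        rintro ⟨h2, h, h3⟩
        exact hadj i v h2 h h3
    obtain ⟨δ', h1, h2, h3⟩ := ih (List.nodup_cons.1 hl).2 (place G t δ (k, a i) (slot i)) (by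
      intro i' hi'
      have : slot i' ≠ slot i := fun h => hi (hinj h ▸ hi')
      rw [hp, if_neg this]
      exact hδ i' (by simp [hi'])) (by
      intro i' v hv h
      have : v ≠ slot i := by rintro rfl; exact hind _ _ hv
      rw [hp, if_neg this]
      exact hadj i' v hv h)
    refine ⟨δ', Reach.cons (slot i) (hδ i (by simp)) rfl h1, ?_, ?_⟩
    · intro i' hi'
      rcases List.mem_cons.1 hi' with rfl | h
      · rw [h3, hp, if_pos rfl]
        intro i'' h'' he
        exact hi (hinj he ▸ h'')
      · exact h2 i' h
    · intro v hv
      rw [h3 v (fun i' h => hv i' (by simp [h])), hp, if_neg (hv i (by simp)).symm]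

theorem backward (m B : ℕ) (a : Fin (3*m) → ℕ)
    (ha : ∀ i, B < 4 * a i ∧ 2 * a i < B) (f : Fin (3*m) → Fin m)
    (hf : ∀ j : Fin m, (Finset.univ.filter (fun i => f i = j)).card = 3)
    (hs : ∀ j : Fin m, ∑ i ∈ Finset.univ.filter (fun i => f i = j), a i = B) :
    Emptyable (disjointGadgets m) (B+4) (SfullG m a (B+4)) := by
  let e : ∀ j : Fin m, {i // i ∈ Finset.univ.filter (fun i => f i = j)} ≃ Fin 3 :=
    fun j => Finset.equivFinOfCardEq (hf j)
  let σ : Fin m → Fin 3 → Fin (3*m) := fun j k => ((e j).symm k).1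
  have hσf : ∀ j k, f (σ j k) = j := fun j k => (Finset.mem_filter.1 ((e j).symm k).2).2
  have hσs : ∀ i, ∃ k, σ (f i) k = i := fun i => ⟨e (f i) ⟨i, by simp⟩, by simp [σ]⟩
  choose τ hτ using hσs
  have hτσ : ∀ j k, τ (σ j k) = k := by
    intro j k
    have h1 := hτ (σ j k)
    rw [hσf] at h1
    exact (e j).symm.injective (Subtype.ext h1)
  have hsumσ : ∀ j, a (σ j 0) + a (σ j 1) + a (σ j 2) = B := by
    intro j
    rw [← hs j, ← Finset.sum_coe_sort, ← Equiv.sum_comp (e j).symm, Fin.sum_univ_three]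
  let slot : Fin (3*m) → Fin m × GadgetV := fun i => (f i, .lb (τ i).succ)
  have hslot : Function.Injective slot := by
    intro i i' h
    simp only [slot, Prod.mk.injEq, GadgetV.lb.injEq, Fin.succ_inj] at h
    rw [← hτ i, ← hτ i', h.1, h.2]
  have hslotσ : ∀ j k, slot (σ j k) = (j, .lb k.succ) := by
    intro j k; simp [slot, hσf, hτσ]
  let n := B + 3
  let δ1 : Config (Fin m × GadgetV) (GColor m) := fun v =>
    gc (some (some (v.1, 0), n)) (some (some (v.1, 1), n))
      ![none, some (some (v.1, 1), n), some (some (v.1, 2), n), some (some (v.1, 2), n)]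
        ![some (some (v.1, 0), n), none, none, none] v.2
  have R1 : Reach (disjointGadgets m) (B+4) (emptyConfig _ _) (SinitialG m (B+4)) δ1 := by
    have := Reach.blocksAll (m := m) (C := GColor m) (t := n + 1)
      (fun j => [(some (j, 0), n), (some (j, 0), n), (some (j, 1), n),
       (some (j, 1), n), (some (j, 2), n), (some (j, 2), n)])
      (fun j => gc none none ![none, none, none, none] ![none, none, none, none])
      (fun j => gc (some (some (j, 0), n)) (some (some (j, 1), n))
      ![none, some (some (j, 1), n), some (some (j, 2), n), some (some (j, 2), n)]
        ![some (some (j, 0), n), none, none, none])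
      (fun j => reach_init n (by omega) _ _ _ (by simp) (by simp) (by simp))
    have he : emptyConfig (Fin m × GadgetV) (GColor m) =
        fun v => gc none none ![none, none, none, none] ![none, none, none, none] v.2 := by
      funext ⟨j, u⟩
      rcases u with _ | _ | i | i <;> try rfl
      all_goals fin_cases i <;> rfl
    rw [he]
    exact this
  obtain ⟨δ2, R2, h21, h22⟩ := reach_slots (disjointGadgets m) (B+4) (none : GColor m) a slot hslot
    (by intro i i'; simp only [slot, dadj]; simp [-SimpleGraph.fromRel_adj])
    (fun i => by have := ha i; omega)
    (List.finRange (3*m)) (List.nodup_finRange _) δ1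
    (by
      intro i _
      simp only [slot, δ1, gc]
      generalize τ i = k
      fin_cases k <;> rfl)
    (by
      rintro i ⟨j, u⟩ h hh
      simp only [slot, dadj] at h
      obtain ⟨rfl, h⟩ := h
      rcases u with _ | _ | k | k
      · simp [δ1, gc]
      · simp [δ1, gc]
      · fin_cases k <;> simp [δ1, gc]
      · simp [-SimpleGraph.fromRel_adj] at h)
  have hδ2 : δ2 = fun v : Fin m × GadgetV =>
    (fun j => gc (some (some (j, 0), n)) (some (some (j, 1), n))
      ![none, some (some (j, 1), n), some (some (j, 2), n), some (some (j, 2), n)]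
        ![some (some (j, 0), n), some (none, a (σ j 0)), some (none, a (σ j 1)), some (none, a (σ j 2))]) v.1 v.2 := by
    funext ⟨j, u⟩
    have hlb : ∀ k : Fin 3, δ2 (j, .lb k.succ) = some (none, a (σ j k)) := by
      intro k
      rw [← hslotσ, h21 _ (by simp)]
    rcases u with _ | _ | k | k
    · rw [h22 _ (by simp [slot])]; rfl
    · rw [h22 _ (by simp [slot])]; rfl
    · rw [h22 _ (by simp [slot])]; rfl
    · refine Fin.cases ?_ (fun k => ?_) k
      · rw [h22 _ (by simp [slot, Fin.succ_ne_zero])]; rfl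
      · rw [hlb]; fin_cases k <;> rfl
  have R3 := Reach.blocksAll (m := m) (t := n + 1)
      (fun j => [((some (j, 0) : GColor m), n), (some (j, 1), n), (some (j, 2), n)]) _ _
      (fun j => reach_conn n (by omega) (some (j, 0)) (some (j, 1)) (some (j, 2)) none
        (by simp) (by simp) (by simp) (a (σ j 0)) (a (σ j 1)) (a (σ j 2)))
  have R4 := Reach.blocksAll (m := m) (t := B + 4)
      (fun j => [((none : GColor m), 1), (none, 1), (none, 1), (none, 1)]) _ _
      (fun j => reach_final B (none : GColor m) (a (σ j 0)) (a (σ j 1)) (a (σ j 2)) (hsumσ j))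
  rw [← hδ2] at R3
  have R := ((R1.append R2).append R3).append R4
  obtain ⟨p, hp1, hp2⟩ := R
  refine ⟨p, hp1, ?_⟩
  refine hp2.trans ?_
  funext ⟨j, u⟩
  rcases u with _ | _ | i | i <;> try rfl
  all_goals fin_cases i <;> rfl

end Hexasort
namespace Hexasort

def Traj {V C : Type*} [Fintype V] (G : SimpleGraph V) (t N : ℕ) (conf : ℕ → Config V C)
    (stk : ℕ → C × ℕ) (pos : ℕ → V) : Prop :=
  ∀ k < N, conf k (pos k) = none ∧ conf (k+1) = place G t (conf k) (stk k) (pos k)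

theorem Traj.of_legal {V C : Type*} [Fintype V] {G : SimpleGraph V} {t : ℕ} {δ : Config V C}
    {S : List (C × ℕ)} {p : List V} (h : Legal G t δ S p) (d : V) (s0 : C × ℕ) :
    ∃ conf : ℕ → Config V C, conf 0 = δ ∧ conf S.length = play G t δ S p ∧
      Traj G t S.length conf (fun k => S.getD k s0) (fun k => p.getD k d) := by
  induction h with
  | nil δ => exact ⟨fun _ => δ, rfl, rfl, by intro k hk; simp at hk⟩
  | @cons δ s S x p hx _ ih =>
    obtain ⟨conf, h0, h1, h2⟩ := ih
    refine ⟨fun k => Nat.casesOn k δ conf, rfl, h1, ?_⟩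
    intro k hk
    rcases k with _ | k
    · exact ⟨hx, h0⟩
    · exact h2 k (by simpa using hk)

section
variable {V C : Type*} [Fintype V] {G : SimpleGraph V} {t N : ℕ} {conf : ℕ → Config V C}
    {stk : ℕ → C × ℕ} {pos : ℕ → V}

theorem Traj.persist (hT : Traj G t N conf stk pos) {k K : ℕ} (hkK : k ≤ K) {u : V} {c : C} {h : ℕ}
    (hu : conf k u = some (c, h)) (hK : K ≤ N)
    (hn : ∀ k', k ≤ k' → k' < K → (stk k').1 = c → ¬ G.Adj (pos k') u) :
    conf K u = some (c, h) := by
  induction K, hkK using Nat.le_induction with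
  | base => exact hu
  | succ K hkK ih =>
    have ih := ih (by omega) (fun k' h1 h2 => hn k' h1 (by omega))
    obtain ⟨h1, h2⟩ := hT K (by omega)
    rw [h2]
    simp only [place]
    rw [if_neg, if_neg, ih]
    · rintro ⟨h3, hh, h4⟩
      rw [ih] at h4
      simp only [Option.some.injEq, Prod.mk.injEq] at h4
      exact hn K hkK (by omega) h4.1.symm h3
    · rintro rfl
      rw [h1] at ih; simp at ih

theorem Traj.back (hT : Traj G t N conf stk pos) {k : ℕ} (hk : k < N) {v : V} {c : C} {h : ℕ}
    (hv : conf (k+1) v = some (c, h)) : (v = pos k ∧ (stk k).1 = c) ∨ conf k v = some (c, h) := by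
  obtain ⟨h1, h2⟩ := hT k hk
  rw [h2] at hv
  simp only [place] at hv
  split_ifs at hv with h3 h4 h5
  · left; simp only [Option.some.injEq, Prod.mk.injEq] at hv; exact ⟨h3, hv.1⟩
  · right; exact hv

theorem Traj.origin (hT : Traj G t N conf stk pos) {k0 K : ℕ} (hkK : k0 ≤ K) (hK : K ≤ N) {v : V} {c : C} {h : ℕ}
    (hv : conf K v = some (c, h)) :
    (∃ k, k0 ≤ k ∧ k < K ∧ pos k = v ∧ (stk k).1 = c) ∨ conf k0 v = some (c, h) := by
  induction K, hkK using Nat.le_induction with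
  | base => exact Or.inr hv
  | succ K hkK ih =>
    rcases hT.back (by omega) hv with h1 | h1
    · exact Or.inl ⟨K, hkK, by omega, h1.1.symm, h1.2⟩
    · rcases ih (by omega) h1 with ⟨k, h2, h3, h4⟩ | h2
      · exact Or.inl ⟨k, h2, by omega, h4⟩
      · exact Or.inr h2

theorem nsum_zero {δ : Config V C} {c : C} {x : V} (h : ∀ y, G.Adj x y → ∀ hh, δ y ≠ some (c, hh)) :
    neighborSum G δ c x = 0 := by
  apply Finset.sum_eq_zero
  intro y hy
  simp only [Finset.mem_filter, Finset.mem_univ, true_and] at hy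
  rcases hc : δ y with _ | ⟨c', h'⟩
  · rfl
  · have := h y hy h'
    simp only [colorHeight]
    rw [if_neg]
    rintro rfl
    exact this hc

theorem Traj.put (hT : Traj G t N conf stk pos) {k : ℕ} (hk : k < N) {c : C} {h : ℕ}
    (hs : stk k = (c, h)) (ht : h < t)
    (hn : ∀ y, G.Adj (pos k) y → ∀ hh, conf k y ≠ some (c, hh)) :
    conf (k+1) (pos k) = some (c, h) := by
  rw [(hT k hk).2]
  simp [place, hs, nsum_zero hn, ht]

theorem Traj.triple (hT : Traj G t N conf stk pos) (h0 : conf 0 = emptyConfig V C)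
    (hN : conf N = emptyConfig V C) (ht : 2 ≤ t) {k1 k2 k3 : ℕ} {c : C} (h12 : k1 < k2) (h23 : k2 < k3)
    (h3N : k3 < N) (s1 : stk k1 = (c, t-1)) (s2 : stk k2 = (c, t-1)) (s3 : stk k3 = (c, t-1))
    (hu : ∀ k < N, (stk k).1 = c → k = k1 ∨ k = k2 ∨ k = k3) :
    pos k1 ≠ pos k2 ∧ G.Adj (pos k3) (pos k1) ∧ G.Adj (pos k3) (pos k2) ∧
    (∀ K, k1 < K → K ≤ k3 → conf K (pos k1) = some (c, t-1)) ∧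
    (∀ K, k2 < K → K ≤ k3 → conf K (pos k2) = some (c, t-1)) := by
  have hor : ∀ K ≤ N, ∀ v h, conf K v = some (c, h) → ∃ k < K, pos k = v ∧ (k = k1 ∨ k = k2 ∨ k = k3) := by
    intro K hK v h hv
    rcases hT.origin (Nat.zero_le K) hK hv with ⟨k, _, h2, h3, h4⟩ | h1
    · exact ⟨k, h2, h3, hu k (by omega) h4⟩
    · rw [h0] at h1; simp [emptyConfig] at h1
  have c1 : conf (k1+1) (pos k1) = some (c, t-1) := by
    refine hT.put (by omega) s1 (by omega) ?_
    intro y _ hh hy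
    obtain ⟨k, h1, h2, h3⟩ := hor k1 (by omega) _ _ hy
    omega
  have c2 : conf k2 (pos k1) = some (c, t-1) := by
    refine hT.persist (by omega) c1 (by omega) ?_
    intro k' h1 h2 h3
    have := hu k' (by omega) h3
    omega
  have hne : pos k1 ≠ pos k2 := by
    intro h
    rw [h, (hT k2 (by omega)).1] at c2
    simp at c2
  have hFin : ∀ k ≤ N, ∀ u, conf k u = some (c, t-1) →
      (∀ k', k ≤ k' → k' < N → (stk k').1 = c → ¬ G.Adj (pos k') u) → False := by
    intro k hk u h1 h2
    have := hT.persist hk h1 le_rfl h2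
    rw [hN] at this
    simp [emptyConfig] at this
  have hnadj : ¬ G.Adj (pos k2) (pos k1) := by
    intro hadj
    have hno : ∀ v h, conf (k2+1) v ≠ some (c, h) := by
      intro v h hv
      rw [(hT k2 (by omega)).2] at hv
      simp only [place, s2] at hv
      have hns : t - 1 ≤ neighborSum G (conf k2) c (pos k2) := by
        unfold neighborSum
        have : colorHeight (conf k2 (pos k1)) c = t - 1 := by rw [c2]; simp [colorHeight]
        rw [← this]
        exact Finset.single_le_sum (f := fun y => colorHeight (conf k2 y) c) (fun _ _ => Nat.zero_le _)
          (by simp [hadj])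
      rw [if_pos (show t ≤ t - 1 + _ by omega)] at hv
      split_ifs at hv with h1 h2
      obtain ⟨k, h4, h5, h6⟩ := hor k2 (by omega) _ _ hv
      have : k = k1 := by omega
      subst this
      subst h5
      exact h2 ⟨hadj, _, c2⟩
    have c3 : conf (k3+1) (pos k3) = some (c, t-1) := by
      refine hT.put (by omega) s3 (by omega) ?_
      intro y _ hh hy
      rcases hT.origin (show k2+1 ≤ k3 by omega) (by omega) hy with ⟨k, h1, h2, h3, h4⟩ | h1
      · have := hu k (by omega) h4
        omega
      · exact hno _ _ h1
    refine hFin (k3+1) (by omega) _ c3 ?_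
    intro k' h1 h2 h3
    have := hu k' (by omega) h3
    omega
  have c4 : conf (k2+1) (pos k2) = some (c, t-1) := by
    refine hT.put (by omega) s2 (by omega) ?_
    intro y hadj hh hy
    obtain ⟨k, h1, h2, h3⟩ := hor k2 (by omega) _ _ hy
    have : k = k1 := by omega
    subst this
    exact hnadj (h2 ▸ hadj)
  have f1 : ∀ K, k1 < K → K ≤ k3 → conf K (pos k1) = some (c, t-1) := by
    intro K hK1 hK3
    refine hT.persist hK1 c1 (by omega) ?_
    intro k' h1 h2 h3
    have := hu k' (by omega) h3
    have : k' = k2 := by omega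
    subst this
    exact hnadj
  have f2 : ∀ K, k2 < K → K ≤ k3 → conf K (pos k2) = some (c, t-1) := by
    intro K hK1 hK3
    refine hT.persist hK1 c4 (by omega) ?_
    intro k' h1 h2 h3
    have := hu k' (by omega) h3
    omega
  refine ⟨hne, ?_, ?_, f1, f2⟩
  · by_contra hc
    refine hFin k3 (by omega) _ (f1 k3 (by omega) le_rfl) ?_
    intro k' h1 h2 h3
    have := hu k' (by omega) h3
    have : k' = k3 := by omega
    subst this
    exact hc
  · by_contra hc
    refine hFin k3 (by omega) _ (f2 k3 (by omega) le_rfl) ?_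
    intro k' h1 h2 h3
    have := hu k' (by omega) h3
    have : k' = k3 := by omega
    subst this
    exact hc

theorem Traj.weight (hT : Traj G t N conf stk pos) (hN : conf N = emptyConfig V C) {k0 : ℕ} {c : C}
    (hk0 : k0 ≤ N) (hs : ∀ k, k0 ≤ k → k < N → stk k = (c, 1)) (U : Finset V)
    (hbd : ∀ u ∈ U, ∀ v, v ∉ U → G.Adj u v →
      (∀ h, conf k0 v ≠ some (c, h)) ∧ ∀ k, k0 ≤ k → k < N → pos k ≠ v)
    (hne : ∃ u ∈ U, ∃ h, conf k0 u = some (c, h)) :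
    t ≤ ∑ u ∈ U, colorHeight (conf k0 u) c + ((Finset.Ico k0 N).filter (fun k => pos k ∈ U)).card := by
  have hbd' : ∀ u ∈ U, ∀ v, v ∉ U → G.Adj u v → ∀ K, k0 ≤ K → K ≤ N → ∀ h, conf K v ≠ some (c, h) := by
    intro u hu v hv hadj K hK1 hK2 h hc
    obtain ⟨b1, b2⟩ := hbd u hu v hv hadj
    rcases hT.origin hK1 hK2 hc with ⟨k, h1, h2, h3, h4⟩ | h1
    · exact b2 k h1 (by omega) h3
    · exact b1 _ h1
  have key : ∀ K, k0 ≤ K → K ≤ N →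
      t ≤ ∑ u ∈ U, colorHeight (conf k0 u) c + ((Finset.Ico k0 K).filter (fun k => pos k ∈ U)).card ∨
      (∑ u ∈ U, colorHeight (conf K u) c ≤
        ∑ u ∈ U, colorHeight (conf k0 u) c + ((Finset.Ico k0 K).filter (fun k => pos k ∈ U)).card ∧
        ∃ u ∈ U, ∃ h, conf K u = some (c, h)) := by
    intro K hK
    induction K, hK using Nat.le_induction with
    | base => intro _; right; exact ⟨by simp, hne⟩
    | succ K hK ih =>
      intro hKN
      have ih := ih (by omega)
      obtain ⟨e1, e2⟩ := hT K (by omega)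
      have es := hs K hK (by omega)
      have hico : Finset.Ico k0 (K+1) = insert K (Finset.Ico k0 K) := by
        ext k; simp only [Finset.mem_Ico, Finset.mem_insert]; omega
      rw [hico, Finset.filter_insert]
      by_cases hx : pos K ∈ U
      · rw [if_pos hx, Finset.card_insert_of_notMem (by simp)]
        rcases ih with ih | ⟨ih1, ih2⟩
        · left; omega
        have hns : neighborSum G (conf K) c (pos K) =
            ∑ u ∈ U, if G.Adj (pos K) u then colorHeight (conf K u) c else 0 := by
          unfold neighborSum
          rw [Finset.sum_filter]
          symm
          apply Finset.sum_subset (Finset.subset_univ U)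
          intro v _ hv
          split_ifs with hadj
          · rcases hc : conf K v with _ | ⟨c', h'⟩
            · rfl
            · simp only [colorHeight]
              rw [if_neg]
              rintro rfl
              exact hbd' _ hx v hv hadj K hK (by omega) h' hc
          · rfl
        have hle : neighborSum G (conf K) c (pos K) ≤ ∑ u ∈ U, colorHeight (conf K u) c := by
          rw [hns]
          apply Finset.sum_le_sum
          intro u _
          split_ifs <;> omega
        by_cases hcl : t ≤ 1 + neighborSum G (conf K) c (pos K)
        · left; omega
        · right
          have hnew : conf (K+1) (pos K) = some (c, 1 + neighborSum G (conf K) c (pos K)) := by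
            rw [e2]; simp only [place, es]; simp [hcl]
          refine ⟨?_, pos K, hx, _, hnew⟩
          have : ∑ u ∈ U, colorHeight (conf (K+1) u) c +
              (∑ u ∈ U, if G.Adj (pos K) u then colorHeight (conf K u) c else 0) ≤
              ∑ u ∈ U, colorHeight (conf K u) c +
              ∑ u ∈ U, if u = pos K then 1 + neighborSum G (conf K) c (pos K) else 0 := by
            rw [← Finset.sum_add_distrib, ← Finset.sum_add_distrib]
            apply Finset.sum_le_sum
            intro u _
            by_cases hu : u = pos K
            · subst hu
              rw [hnew]
              simp [colorHeight]
            · rw [if_neg hu, e2]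
              simp only [place, es]
              rw [if_neg hu]
              by_cases hadj : G.Adj (pos K) u
              · by_cases hc : ∃ hh, conf K u = some (c, hh)
                · simp [hadj, hc, colorHeight]
                · have : colorHeight (conf K u) c = 0 := by
                    rcases hc' : conf K u with _ | ⟨c', h'⟩
                    · rfl
                    · simp only [colorHeight]
                      rw [if_neg]
                      rintro rfl
                      exact hc ⟨_, hc'⟩
                  simp [hc, this]
              · simp [hadj]
          rw [Finset.sum_ite_eq' U, if_pos hx, ← hns] at this
          omega
      · rw [if_neg hx]
        have hsame : ∀ u ∈ U, conf (K+1) u = conf K u := by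
          intro u hu
          rw [e2]
          simp only [place]
          rw [if_neg (by rintro rfl; exact hx hu), if_neg]
          rintro ⟨h1, _⟩
          exact (hbd u hu _ hx h1.symm).2 K hK (by omega) rfl
        rcases ih with ih | ⟨ih1, u, hu, h, hh⟩
        · exact Or.inl ih
        · right
          refine ⟨?_, u, hu, h, by rw [hsame u hu, hh]⟩
          rw [Finset.sum_congr rfl (fun u hu => by rw [hsame u hu])]
          exact ih1
  rcases key N hk0 le_rfl with h | ⟨_, u, _, h, hh⟩
  · exact h
  · rw [hN] at hh; simp [emptyConfig] at hh
end

end Hexasort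
namespace Hexasort

theorem flatMap_getElem? {α : Type*} (m q : ℕ) (F : Fin m → Fin q → α) (j : Fin m) (r : Fin q) :
    ((List.finRange m).flatMap (fun j => List.ofFn (F j)))[(j:ℕ) * q + r]? = some (F j r) := by
  have hq : 0 < q := r.pos
  let f : Fin (m * q) → α := fun k => F ⟨k / q, Nat.div_lt_of_lt_mul (lt_of_lt_of_eq k.2 (mul_comm m q))⟩
    ⟨k % q, Nat.mod_lt _ hq⟩
  have h := List.ofFn_mul f
  have h2 : (List.finRange m).flatMap (fun j => List.ofFn (F j)) = List.ofFn f := by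
    rw [h, List.flatMap, ← List.ofFn_eq_map]
    congr 2
    funext i
    congr 1
    funext r
    simp only [f]
    have e1 : ((i:ℕ) * q + r) / q = i := by
      rw [mul_comm, Nat.mul_add_div hq, Nat.div_eq_of_lt r.2, add_zero]
    have e2 : ((i:ℕ) * q + r) % q = r := by
      rw [mul_comm, Nat.mul_add_mod, Nat.mod_eq_of_lt r.2]
    simp [e1, e2]
  have hlt : (j:ℕ) * q + r < m * q := by
    calc (j:ℕ) * q + r < j * q + q := by omega
      _ = (j + 1) * q := by ring
      _ ≤ m * q := Nat.mul_le_mul_right _ j.2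
  rw [h2, List.getElem?_ofFn, dif_pos hlt]
  simp only [f]
  have e1 : ((j:ℕ) * q + r) / q = j := by
    rw [mul_comm, Nat.mul_add_div hq, Nat.div_eq_of_lt r.2, add_zero]
  have e2 : ((j:ℕ) * q + r) % q = r := by
    rw [mul_comm, Nat.mul_add_mod, Nat.mod_eq_of_lt r.2]
  simp [e1, e2]

def stkF (m t : ℕ) (a : Fin (3*m) → ℕ) (k : ℕ) : GColor m × ℕ :=
  if h : k < 6*m then (some (⟨k/6, by omega⟩, ⟨k%6/2, by omega⟩), t-1)
  else if h : k < 9*m then (none, a ⟨k - 6*m, by omega⟩)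
  else if h : k < 12*m then (some (⟨(k-9*m)/3, by omega⟩, ⟨(k-9*m)%3, by omega⟩), t-1)
  else (none, 1)

theorem len_init (m t : ℕ) : (SinitialG m t).length = 6*m := by
  simp [SinitialG, List.length_flatMap, mul_comm]
theorem len_A (m : ℕ) (a : Fin (3*m) → ℕ) : (SAG m a).length = 3*m := by
  simp [SAG]
theorem len_conn (m t : ℕ) : (SconnectorG m t).length = 3*m := by
  simp [SconnectorG, List.length_flatMap, mul_comm]
theorem len_final (m : ℕ) : (SfinalG m).length = 4*m := by
  simp [SfinalG, List.length_flatMap, mul_comm]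
theorem len_full (m t : ℕ) (a : Fin (3*m) → ℕ) : (SfullG m a t).length = 16*m := by
  simp only [SfullG, List.length_append, len_init, len_A, len_conn, len_final]; omega

theorem get_init (m t k : ℕ) (h : k < 6*m) : (SinitialG m t)[k]? =
    some (some (⟨k/6, by omega⟩, ⟨k%6/2, by omega⟩), t-1) := by
  have := flatMap_getElem? m 6 (fun j r => ((some (j, ⟨r/2, by omega⟩) : GColor m), t-1))
    ⟨k/6, by omega⟩ ⟨k%6, by omega⟩
  simp only [show k/6*6 + k%6 = k by omega] at this
  rw [← this]
  rfl

theorem get_conn (m t k : ℕ) (h : k < 3*m) : (SconnectorG m t)[k]? =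
    some (some (⟨k/3, by omega⟩, ⟨k%3, by omega⟩), t-1) := by
  have := flatMap_getElem? m 3 (fun j r => ((some (j, r) : GColor m), t-1))
    ⟨k/3, by omega⟩ ⟨k%3, by omega⟩
  simp only [show k/3*3 + k%3 = k by omega] at this
  rw [← this]
  rfl

theorem get_final (m k : ℕ) (h : k < 4*m) : (SfinalG m)[k]? = some (none, 1) := by
  have := flatMap_getElem? m 4 (fun j r => ((none : GColor m), 1))
    ⟨k/4, by omega⟩ ⟨k%4, by omega⟩
  simp only [show k/4*4 + k%4 = k by omega] at this
  rw [← this]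
  rfl

theorem get_full (m t : ℕ) (a : Fin (3*m) → ℕ) (k : ℕ) (hk : k < 16*m) :
    (SfullG m a t)[k]? = some (stkF m t a k) := by
  unfold SfullG stkF
  split_ifs with h1 h2 h3
  · rw [List.getElem?_append_left (by simp [len_init, len_A, len_conn]; omega),
      List.getElem?_append_left (by simp [len_init, len_A]; omega),
      List.getElem?_append_left (by simp [len_init]; omega), get_init _ _ _ h1]
  · rw [List.getElem?_append_left (by simp [len_init, len_A, len_conn]; omega),
      List.getElem?_append_left (by simp [len_init, len_A]; omega),
      List.getElem?_append_right (by simp [len_init]; omega), len_init]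
    have h4 : k - 6*m < 3*m := by omega
    simp [SAG, h4]
  · rw [List.getElem?_append_left (by simp [len_init, len_A, len_conn]; omega),
      List.getElem?_append_right (by simp [len_init, len_A]; omega), List.length_append, len_init, len_A,
      show 6*m+3*m = 9*m by omega, get_conn _ _ _ (by omega)]
  · rw [List.getElem?_append_right (by simp [len_init, len_A, len_conn]; omega),
      get_final _ _ (by simp [len_init, len_A, len_conn]; omega)]

theorem adj_cases {m : ℕ} {w p q : Fin m × GadgetV} (h1 : (disjointGadgets m).Adj w p)
    (h2 : (disjointGadgets m).Adj w q) (hne : p ≠ q) :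
    (w.2 = .x ∧ (p = (w.1, .s) ∨ ∃ i, p = (w.1, .la i)) ∧ (q = (w.1, .s) ∨ ∃ i, q = (w.1, .la i))) ∨
    ∃ i, w.2 = .la i ∧ ((p = (w.1, .x) ∧ q = (w.1, .lb i)) ∨ (q = (w.1, .x) ∧ p = (w.1, .lb i))) := by
  obtain ⟨g, y⟩ := w
  obtain ⟨g1, p⟩ := p
  obtain ⟨g2, q⟩ := q
  rw [dadj] at h1 h2
  obtain ⟨rfl, h1⟩ := h1
  obtain ⟨rfl, h2⟩ := h2
  rcases y with _ | _ | i | i <;> rcases p with _ | _ | p | p <;> rcases q with _ | _ | q | q <;>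
    simp_all [-SimpleGraph.fromRel_adj]

set_option maxHeartbeats 4000000 in
theorem forward_core (m B : ℕ) (a : Fin (3*m) → ℕ)
    (ha : ∀ i, B < 4 * a i ∧ 2 * a i < B)
    (hsum : ∑ i, a i = m * B)
    (conf : ℕ → Config (Fin m × GadgetV) (GColor m)) (stk : ℕ → GColor m × ℕ)
    (pos : ℕ → Fin m × GadgetV)
    (hT : Traj (disjointGadgets m) (B+4) (16*m) conf stk pos)
    (hS : ∀ k < 16*m, stk k = stkF m (B+4) a k)
    (h0 : conf 0 = emptyConfig _ _) (hN : conf (16*m) = emptyConfig _ _) :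
      ∃ f : Fin (3*m) → Fin m,
        (∀ j : Fin m, (Finset.univ.filter (fun i => f i = j)).card = 3) ∧
        (∀ j : Fin m, ∑ i ∈ Finset.univ.filter (fun i => f i = j), a i = B) := by
  -- facts on the sequence
  let P : Fin m × Fin 3 → Fin 2 → Fin m × GadgetV := fun c b => pos (6*c.1 + 2*c.2 + b)
  let T3 : Fin m × Fin 3 → ℕ := fun c => 9*m + 3*c.1 + c.2
  have hT3 : ∀ c, 9*m ≤ T3 c ∧ T3 c < 12*m := by
    intro c; have := c.1.2; have := c.2.2; simp only [T3]; omega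
  have s12 : ∀ (c : Fin m × Fin 3) (b : Fin 2), stk (6*c.1 + 2*c.2 + b) = (some c, B+4-1) := by
    intro c b
    have := c.1.2; have := c.2.2; have := b.2
    rw [hS _ (by omega)]
    unfold stkF
    rw [dif_pos (by omega)]
    congr 3
    · apply Fin.ext; simp only; omega
    · apply Fin.ext; simp only; omega
  have s3 : ∀ c : Fin m × Fin 3, stk (T3 c) = (some c, B+4-1) := by
    intro c
    have := c.1.2; have := c.2.2; have := hT3 c
    rw [hS _ (by omega)]
    unfold stkF
    rw [dif_neg (by omega), dif_neg (by omega), dif_pos (by omega)]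
    congr 3
    · apply Fin.ext; simp only [T3]; omega
    · apply Fin.ext; simp only [T3]; omega
  have hu : ∀ c : Fin m × Fin 3, ∀ k < 16*m, (stk k).1 = some c →
      k = 6*c.1 + 2*c.2 + (0 : Fin 2) ∨ k = 6*c.1+2*c.2+(1 : Fin 2) ∨ k = T3 c := by
    rintro ⟨j, κ⟩ k hk h
    rw [hS k hk] at h
    unfold stkF at h
    simp only [T3, Fin.val_zero, Fin.val_one]
    split_ifs at h with h1 h2 h3
    · simp only [Option.some.injEq, Prod.mk.injEq, Fin.ext_iff] at h
      omega
    · simp only [Option.some.injEq, Prod.mk.injEq, Fin.ext_iff] at h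
      omega
  have sA : ∀ i : Fin (3*m), stk (6*m+i) = (none, a i) := by
    intro i
    have := i.2
    rw [hS _ (by omega)]
    unfold stkF
    rw [dif_neg (by omega), dif_pos (by omega)]
    congr 3
    omega
  have sF : ∀ k, 12*m ≤ k → k < 16*m → stk k = (none, 1) := by
    intro k h1 h2
    rw [hS _ h2]
    unfold stkF
    rw [dif_neg (by omega), dif_neg (by omega), dif_neg (by omega)]
  have hblack : ∀ k < 16*m, (stk k).1 = none → (∃ i : Fin (3*m), k = 6*m+i) ∨ 12*m ≤ k := by
    intro k hk h
    rw [hS k hk] at h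
    unfold stkF at h
    split_ifs at h with h1 h2 h3
    · left; exact ⟨⟨k-6*m, by omega⟩, by simp only; omega⟩
    · right; omega
  clear hS
  -- colour triples
  let w : Fin m × Fin 3 → Fin m × GadgetV := fun c => pos (T3 c)
  have trip := fun c : Fin m × Fin 3 => hT.triple h0 hN (show 2 ≤ B+4 by omega)
    (show 6*(c.1:ℕ) + 2*c.2 + (0 : Fin 2) < 6*c.1 + 2*c.2 + (1 : Fin 2) by simp)
    (show _ < T3 c by have := hT3 c; have := c.1.2; have := c.2.2; simp only [Fin.val_one]; omega)
    (by have := hT3 c; omega)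
    (s12 c 0) (s12 c 1) (s3 c) (hu c)
  have F1 : ∀ c, P c 0 ≠ P c 1 := fun c => (trip c).1
  have F2 : ∀ c b, (disjointGadgets m).Adj (w c) (P c b) := by
    intro c b
    fin_cases b
    · exact (trip c).2.1
    · exact (trip c).2.2.1
  have F4 : ∀ c b K, 6*m ≤ K → K ≤ T3 c → conf K (P c b) = some (some c, B+4-1) := by
    intro c b K h1 h2
    have := c.1.2; have := c.2.2
    fin_cases b
    · exact (trip c).2.2.2.1 K (by simp only [Fin.val_zero]; omega) h2
    · exact (trip c).2.2.2.2 K (by simp only [Fin.val_one]; omega) h2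
  have F6 : ∀ c, conf (T3 c) (w c) = none := fun c => (hT _ (by have := hT3 c; omega)).1
  clear trip
  have hPinj : ∀ c b c' b', P c b = P c' b' → c = c' ∧ b = b' := by
    intro c b c' b' h
    have h1 := F4 c b (6*m) le_rfl (by have := hT3 c; omega)
    have h2 := F4 c' b' (6*m) le_rfl (by have := hT3 c'; omega)
    rw [h, h2] at h1
    simp only [Option.some.injEq, Prod.mk.injEq, and_true] at h1
    subst h1
    refine ⟨rfl, ?_⟩
    have hne := F1 c'
    fin_cases b <;> fin_cases b'
    · rfl
    · exact absurd h hne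
    · exact absurd h.symm hne
    · rfl
  have hcase := fun c => adj_cases (F2 c 0) (F2 c 1) (F1 c)
  have hX : ∀ c g, w c = (g, .x) → ∀ b, P c b = (g, .s) ∨ ∃ i, P c b = (g, .la i) := by
    intro c g h b
    have := hcase c
    rw [h] at this
    simp at this
    fin_cases b
    · exact this.1
    · exact this.2
  have hL : ∀ c g i, w c = (g, .la i) → (∃ b, P c b = (g, .x)) ∧ ∃ b, P c b = (g, .lb i) := by
    intro c g i h
    have := hcase c
    rw [h] at this
    simp at this
    rcases this with h | h
    · exact ⟨⟨_, h.1⟩, ⟨_, h.2⟩⟩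
    · exact ⟨⟨_, h.1⟩, ⟨_, h.2⟩⟩
  have hwc : ∀ c, (w c).2 = .x ∨ ∃ i, (w c).2 = .la i := by
    intro c
    rcases hcase c with h | ⟨i, h, _⟩
    · exact Or.inl h.1
    · exact Or.inr ⟨i, h⟩
  let XS : Fin m → Finset (Fin m × Fin 3) := fun g => Finset.univ.filter (fun c => w c = (g, .x))
  let LS : Fin m → Finset (Fin m × Fin 3) := fun g => Finset.univ.filter (fun c => ∃ i, w c = (g, .la i))
  have hXim : ∀ g, ((XS g ×ˢ (Finset.univ : Finset (Fin 2))).image (fun cb => P cb.1 cb.2)).card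
      = (XS g).card * 2 := by
    intro g
    rw [Finset.card_image_of_injective, Finset.card_product]
    · simp
    · rintro ⟨c, b⟩ ⟨c', b'⟩ h
      obtain ⟨rfl, rfl⟩ := hPinj _ _ _ _ h
      rfl
  have hXc : ∀ g, (XS g).card ≤ 2 := by
    intro g
    have h1 : ((XS g ×ˢ (Finset.univ : Finset (Fin 2))).image (fun cb => P cb.1 cb.2)) ⊆
        insert (g, .s) ((Finset.univ : Finset (Fin 4)).image (fun i => (g, GadgetV.la i))) := by
      intro v hv
      simp only [Finset.mem_image, Finset.mem_product, Finset.mem_univ, and_true, XS,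
        Finset.mem_filter, true_and, Prod.exists] at hv
      obtain ⟨c1, c2, b, hc, rfl⟩ := hv
      rcases hX _ _ hc b with h | ⟨i, h⟩ <;> simp [h]
    have h2 := Finset.card_le_card h1
    have h3 := Finset.card_insert_le (g, GadgetV.s)
      ((Finset.univ : Finset (Fin 4)).image (fun i => (g, GadgetV.la i)))
    have h4 : ((Finset.univ : Finset (Fin 4)).image (fun i => (g, GadgetV.la i))).card ≤ 4 :=
      Finset.card_image_le
    rw [hXim] at h2
    omega
  have hLc : ∀ g, (LS g).card ≤ 1 := by
    intro g
    rw [Finset.card_le_one]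
    intro c hc c' hc'
    simp only [LS, Finset.mem_filter, Finset.mem_univ, true_and] at hc hc'
    obtain ⟨i, hi⟩ := hc
    obtain ⟨i', hi'⟩ := hc'
    obtain ⟨b, hb⟩ := (hL _ _ _ hi).1
    obtain ⟨b', hb'⟩ := (hL _ _ _ hi').1
    exact (hPinj _ _ _ _ (hb.trans hb'.symm)).1
  have hGle : ∀ g, (Finset.univ.filter (fun c => (w c).1 = g)).card ≤ (XS g).card + (LS g).card := by
    intro g
    refine le_trans (Finset.card_le_card ?_) (Finset.card_union_le _ _)
    intro c hc
    simp only [Finset.mem_filter, Finset.mem_univ, true_and, XS, LS, Finset.mem_union] at hc ⊢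
    subst hc
    rcases hwc c with h | ⟨i, h⟩
    · left; exact Prod.ext rfl h
    · right; exact ⟨i, Prod.ext rfl h⟩
  have hGsum : ∑ g : Fin m, (Finset.univ.filter (fun c => (w c).1 = g)).card = ∑ g : Fin m, 3 := by
    have := Finset.card_eq_sum_card_fiberwise (s := (Finset.univ : Finset (Fin m × Fin 3)))
      (t := Finset.univ) (f := fun c => (w c).1) (by intro c _; simp)
    rw [← this]
    simp
  have hGeq := (Finset.sum_eq_sum_iff_of_le (fun g _ => (hGle g).trans (by
    have := hXc g; have := hLc g; omega))).1 hGsum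
  have hXe : ∀ g, (XS g).card = 2 := by
    intro g; have := hXc g; have := hLc g; have := hGle g; have := hGeq g (by simp); omega
  have hLe : ∀ g, ∃ c i, w c = (g, .la i) := by
    intro g
    have h1 : 0 < (LS g).card := by
      have := hXc g; have := hLc g; have := hGle g; have := hGeq g (by simp); omega
    obtain ⟨c, hc⟩ := Finset.card_pos.1 h1
    simp only [LS, Finset.mem_filter, Finset.mem_univ, true_and] at hc
    exact ⟨c, hc⟩
  choose cL iL hwL using hLe
  have hnola : ∀ g c b, P c b ≠ (g, .la (iL g)) := by
    intro g c b h
    have hwx : w c = (g, .x) := by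
      rcases hwc c with h1 | ⟨i, h1⟩
      · have := F2 c b
        rw [h, show w c = ((w c).1, (w c).2) from rfl, dadj] at this
        exact Prod.ext this.1 h1
      · have := F2 c b
        rw [h, show w c = ((w c).1, (w c).2) from rfl, dadj, h1] at this
        simp [-SimpleGraph.fromRel_adj] at this
    obtain ⟨b', hb'⟩ := (hL _ _ _ (hwL g)).1
    have := hT3 c
    have := hT3 (cL g)
    rcases le_total (T3 c) (T3 (cL g)) with hle | hle
    · have h1 := F4 (cL g) b' (T3 c) (by omega) hle
      rw [hb', ← hwx, F6] at h1
      simp at h1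
    · have h1 := F4 c b (T3 (cL g)) (by omega) hle
      rw [h, ← hwL, F6] at h1
      simp at h1
  have hOx : ∀ g, ∃ c b, P c b = (g, .x) := fun g => ⟨_, (hL _ _ _ (hwL g)).1⟩
  have hOlb : ∀ g, ∃ c b, P c b = (g, .lb (iL g)) := fun g => ⟨_, (hL _ _ _ (hwL g)).2⟩
  have hOX : ∀ g, ((XS g ×ˢ (Finset.univ : Finset (Fin 2))).image (fun cb => P cb.1 cb.2)) =
        insert (g, .s) ((Finset.univ.erase (iL g)).image (fun i => (g, GadgetV.la i))) := by
    intro g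
    apply Finset.eq_of_subset_of_card_le
    · intro v hv
      simp only [Finset.mem_image, Finset.mem_product, Finset.mem_univ, and_true, XS,
        Finset.mem_filter, true_and, Prod.exists] at hv
      obtain ⟨c1, c2, b, hc, rfl⟩ := hv
      rcases hX _ _ hc b with h | ⟨i, h⟩
      · simp [h]
      · have hi : i ≠ iL g := by
          rintro rfl; exact hnola _ _ _ h
        simp [h, hi]
    · rw [hXim, hXe]
      refine (Finset.card_insert_le _ _).trans ?_
      have : ((Finset.univ.erase (iL g)).image (fun i => (g, GadgetV.la i))).card ≤ 3 := by
        refine Finset.card_image_le.trans ?_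
        simp [Finset.card_erase_of_mem]
      omega
  have hOs : ∀ g, ∃ c b, P c b = (g, .s) := by
    intro g
    have : (g, GadgetV.s) ∈ ((XS g ×ˢ (Finset.univ : Finset (Fin 2))).image (fun cb => P cb.1 cb.2)) := by
      rw [hOX]; simp
    obtain ⟨cb, _, h⟩ := Finset.mem_image.1 this
    exact ⟨_, _, h⟩
  have hOla : ∀ g k, k ≠ iL g → ∃ c b, P c b = (g, .la k) := by
    intro g k hk
    have : (g, GadgetV.la k) ∈ ((XS g ×ˢ (Finset.univ : Finset (Fin 2))).image (fun cb => P cb.1 cb.2)) := by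
      rw [hOX]; simp [hk]
    obtain ⟨cb, _, h⟩ := Finset.mem_image.1 this
    exact ⟨_, _, h⟩
  clear hOX hXe hGeq hGsum hGle hLc hXc hXim
  -- the A phase
  let q : Fin (3*m) → Fin m × GadgetV := fun i => pos (6*m+i)
  have hq0 : ∀ i : Fin (3*m), conf (6*m+i) (q i) = none := fun i => (hT _ (by have := i.2; omega)).1
  have hqP : ∀ i c b, q i ≠ P c b := by
    intro i c b h
    have h1 := F4 c b (6*m+i) (by omega) (by have := hT3 c; have := i.2; omega)
    rw [← h, hq0] at h1
    simp at h1
  have hqE : ∀ i, q i = ((q i).1, .la (iL (q i).1)) ∨ ∃ k, k ≠ iL (q i).1 ∧ q i = ((q i).1, .lb k) := by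
    intro i
    have hh := hqP i
    generalize q i = v at hh
    obtain ⟨g, y⟩ := v
    rcases y with _ | _ | k | k
    · obtain ⟨c, b, h⟩ := hOx g; exact absurd h.symm (hh c b)
    · obtain ⟨c, b, h⟩ := hOs g; exact absurd h.symm (hh c b)
    · by_cases hk : k = iL g
      · left; simp [hk]
      · obtain ⟨c, b, h⟩ := hOla g k hk; exact absurd h.symm (hh c b)
    · by_cases hk : k = iL g
      · subst hk
        obtain ⟨c, b, h⟩ := hOlb g; exact absurd h.symm (hh c b)
      · right; exact ⟨k, hk, rfl⟩
  have hqN : ∀ i y, (disjointGadgets m).Adj (q i) y → ∃ c b, P c b = y := by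
    rintro i ⟨g, y⟩ h
    rcases hqE i with h1 | ⟨k, hk, h1⟩
    · rw [h1, dadj] at h
      obtain ⟨rfl, h⟩ := h
      rcases y with _ | _ | k | k
      · exact hOx _
      · simp [-SimpleGraph.fromRel_adj] at h
      · simp [-SimpleGraph.fromRel_adj] at h
      · simp only [hadj_lalb] at h
        subst h
        exact hOlb _
    · rw [h1, dadj] at h
      obtain ⟨rfl, h⟩ := h
      rcases y with _ | _ | k | k
      · simp [-SimpleGraph.fromRel_adj] at h
      · simp [-SimpleGraph.fromRel_adj] at h
      · simp only [hadj_lbla] at h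
        subst h
        exact hOla _ _ hk
      · simp [-SimpleGraph.fromRel_adj] at h
  have hqC : ∀ (i : Fin (3*m)) K, 6*m+i < K → K ≤ 12*m → conf K (q i) = some (none, a i) := by
    intro i K h1 h2
    have hi := i.2
    have hput : conf (6*m+i+1) (q i) = some (none, a i) := by
      refine hT.put (by omega) (sA i) (by have := ha i; omega) ?_
      intro y hy hh hc
      obtain ⟨c, b, rfl⟩ := hqN i y hy
      rw [F4 c b _ (by omega) (by have := hT3 c; omega)] at hc
      simp at hc
    refine hT.persist h1 hput (by omega) ?_
    intro k' h3 h4 h5 h6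
    rcases hblack k' (by omega) h5 with ⟨i', rfl⟩ | h7
    · obtain ⟨c, b, h⟩ := hqN i' _ h6
      exact hqP i c b h.symm
    · omega
  have hqlt : ∀ i i', i < i' → q i ≠ q i' := by
    intro i i' h h'
    have := hqC i (6*m+i') (by have : (i:ℕ) < i' := h; omega) (by have := i'.2; omega)
    rw [h', hq0] at this
    simp at this
  have hqinj : Function.Injective q := by
    intro i i' h
    rcases lt_trichotomy i i' with h1 | h1 | h1
    · exact absurd h (hqlt _ _ h1)
    · exact h1
    · exact absurd h.symm (hqlt _ _ h1)
  have hqlb : ∀ i, ∃ k, k ≠ iL (q i).1 ∧ q i = ((q i).1, .lb k) := by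
    intro i
    rcases hqE i with h | h
    · exfalso
      have h1 := hT3 (cL (q i).1)
      have h2 := hqC i (T3 (cL (q i).1)) (by have := i.2; omega) (by omega)
      rw [h] at h2
      simp only at h2
      rw [← hwL, F6] at h2
      simp at h2
    · exact h
  choose κ hκ1 hκ2 using hqlb
  let f : Fin (3*m) → Fin m := fun i => (q i).1
  have himg : ∀ g, ((Finset.univ.filter (fun i => f i = g)).image κ).card =
      (Finset.univ.filter (fun i => f i = g)).card := by
    intro g
    apply Finset.card_image_of_injOn
    intro i hi i' hi' h
    simp only [Finset.coe_filter, Finset.mem_univ, true_and, Set.mem_setOf_eq, f] at hi hi'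
    apply hqinj
    rw [hκ2 i, hκ2 i', hi, hi', h]
  have hsub : ∀ g, ((Finset.univ.filter (fun i => f i = g)).image κ) ⊆ Finset.univ.erase (iL g) := by
    intro g k hk
    obtain ⟨i, hi, rfl⟩ := Finset.mem_image.1 hk
    have hi := (Finset.mem_filter.1 hi).2
    have := hκ1 i
    simp only [f] at hi
    rw [hi] at this
    simp [this]
  have hle3 : ∀ g, (Finset.univ.filter (fun i => f i = g)).card ≤ 3 := by
    intro g
    rw [← himg]
    refine (Finset.card_le_card (hsub g)).trans ?_
    simp [Finset.card_erase_of_mem]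
  have hfsum : ∑ g : Fin m, (Finset.univ.filter (fun i => f i = g)).card = ∑ g : Fin m, 3 := by
    have := Finset.card_eq_sum_card_fiberwise (s := (Finset.univ : Finset (Fin (3*m))))
      (t := Finset.univ) (f := f) (by intro c _; simp)
    rw [← this]
    simp [mul_comm]
  have hcard3 : ∀ g, (Finset.univ.filter (fun i => f i = g)).card = 3 := fun g =>
    (Finset.sum_eq_sum_iff_of_le (fun g _ => hle3 g)).1 hfsum g (by simp)
  have hfull : ∀ g k, k ≠ iL g → ∃ i, q i = (g, .lb k) := by
    intro g k hk
    have h1 := Finset.eq_of_subset_of_card_le (hsub g) (by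
      rw [himg, hcard3]; simp [Finset.card_erase_of_mem])
    have h2 : k ∈ (Finset.univ.filter (fun i => f i = g)).image κ := by rw [h1]; simp [hk]
    obtain ⟨i, hi, rfl⟩ := Finset.mem_image.1 h2
    have hi := (Finset.mem_filter.1 hi).2
    exact ⟨i, by rw [hκ2 i]; simp only [f] at hi; rw [hi]⟩
  -- the final phase
  have hb12 : ∀ v h, conf (12*m) v = some (none, h) → ∃ i, q i = v := by
    intro v h hv
    rcases hT.origin (Nat.zero_le _) (by omega) hv with ⟨k, _, h2, h3, h4⟩ | h1
    · rcases hblack k (by omega) h4 with ⟨i, rfl⟩ | h5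
      · exact ⟨i, h3⟩
      · omega
    · rw [h0] at h1; simp [emptyConfig] at h1
  have hq12 : ∀ i, conf (12*m) (q i) = some (none, a i) := fun i =>
    hqC i _ (by have := i.2; omega) le_rfl
  have hW : ∀ U : Finset (Fin m × GadgetV), ∑ v ∈ U, colorHeight (conf (12*m) v) none =
      ∑ i ∈ Finset.univ.filter (fun i => q i ∈ U), a i := by
    intro U
    have h1 : (Finset.univ.filter (fun i => q i ∈ U)).image q ⊆ U := by
      intro v hv
      obtain ⟨i, hi, rfl⟩ := Finset.mem_image.1 hv
      exact (Finset.mem_filter.1 hi).2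
    rw [← Finset.sum_subset h1, Finset.sum_image (fun _ _ _ _ h => hqinj h)]
    · apply Finset.sum_congr rfl
      intro i _
      rw [hq12]; simp [colorHeight]
    · intro v hv hv'
      rcases hc : conf (12*m) v with _ | ⟨c, h⟩
      · rfl
      · simp only [colorHeight]
        rw [if_neg]
        rintro rfl
        obtain ⟨i, rfl⟩ := hb12 _ _ hc
        exact hv' (Finset.mem_image.2 ⟨i, by simp [hv], rfl⟩)
  let n : Fin m → ℕ := fun g => ((Finset.Ico (12*m) (16*m)).filter (fun k => (pos k).1 = g)).card
  have hnsum : ∑ g, n g = 4*m := by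
    have := Finset.card_eq_sum_card_fiberwise (s := Finset.Ico (12*m) (16*m))
      (t := Finset.univ) (f := fun k => (pos k).1) (by intro c _; simp)
    simp only [n]
    rw [← this, Nat.card_Ico]
    omega
  have hex : ∀ g, ∃ i, f i = g := by
    intro g
    have : 0 < (Finset.univ.filter (fun i => f i = g)).card := by rw [hcard3]; norm_num
    obtain ⟨i, hi⟩ := Finset.card_pos.1 this
    exact ⟨i, (Finset.mem_filter.1 hi).2⟩
  have hAn : ∀ g, B + 4 ≤ ∑ i ∈ Finset.univ.filter (fun i => f i = g), a i + n g := by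
    intro g
    have := hT.weight hN (show 12*m ≤ 16*m by omega) sF (Finset.univ.filter (fun v => v.1 = g))
      (by
        rintro ⟨g1, y1⟩ h1 ⟨g2, y2⟩ h2 hadj
        rw [dadj] at hadj
        simp only [Finset.mem_filter, Finset.mem_univ, true_and] at h1 h2
        exact absurd (hadj.1.symm.trans h1) h2)
      (by
        obtain ⟨i, hi⟩ := hex g
        exact ⟨q i, by simpa using hi, _, hq12 i⟩)
    rw [hW] at this
    simpa using this
  have hla : ∀ g k, k ≠ iL g → ∃ K, 12*m ≤ K ∧ K < 16*m ∧ pos K = (g, .la k) := by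
    intro g k hk
    by_contra hcon
    push Not at hcon
    obtain ⟨i, hi⟩ := hfull g k hk
    have := hT.persist (show 12*m ≤ 16*m by omega) (hq12 i) le_rfl (by
      intro K h1 h2 _ h4
      rw [hi] at h4
      have h5 := hcon K h1 h2
      generalize pos K = v at h4 h5
      obtain ⟨g', y⟩ := v
      rw [dadj] at h4
      obtain ⟨rfl, h4⟩ := h4
      rcases y with _ | _ | k' | k'
      · simp [-SimpleGraph.fromRel_adj] at h4
      · simp [-SimpleGraph.fromRel_adj] at h4
      · simp only [hadj_lalb] at h4
        exact h5 (by rw [h4])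
      · simp [-SimpleGraph.fromRel_adj] at h4)
    rw [hN] at this
    simp [emptyConfig] at this
  have hn4 : ∀ g, 4 ≤ n g := by
    intro g
    by_cases hx : ∃ K, 12*m ≤ K ∧ K < 16*m ∧ pos K = (g, .x)
    · have h1 : insert (g, GadgetV.x) ((Finset.univ.erase (iL g)).image (fun i => (g, GadgetV.la i))) ⊆
          ((Finset.Ico (12*m) (16*m)).filter (fun k => (pos k).1 = g)).image pos := by
        intro v hv
        rcases Finset.mem_insert.1 hv with rfl | hv
        · obtain ⟨K, h1, h2, h3⟩ := hx
          exact Finset.mem_image.2 ⟨K, by simp [h1, h2, h3], h3⟩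
        · obtain ⟨k, hk, rfl⟩ := Finset.mem_image.1 hv
          obtain ⟨K, h1, h2, h3⟩ := hla g k (Finset.ne_of_mem_erase hk)
          exact Finset.mem_image.2 ⟨K, by simp [h1, h2, h3], h3⟩
      have h2 := (Finset.card_le_card h1).trans Finset.card_image_le
      rw [Finset.card_insert_of_notMem (by simp), Finset.card_image_of_injective _ (by
        intro i i' h; simpa using h)] at h2
      simpa [Finset.card_erase_of_mem] using h2
    · push Not at hx
      obtain ⟨i, hi⟩ := hex g
      have hqi : q i = (g, .lb (κ i)) := by rw [hκ2 i]; simp only [f] at hi; rw [hi]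
      have := hT.weight hN (show 12*m ≤ 16*m by omega) sF {(g, .la (κ i)), (g, .lb (κ i))}
        (by
          rintro u hu ⟨g', y⟩ hv hadj
          have hy : g = g' ∧ y = .x := by
            simp only [Finset.mem_insert, Finset.mem_singleton] at hu
            simp only [Finset.mem_insert, Finset.mem_singleton, not_or] at hv
            rcases hu with hu | hu
            · rw [hu, dadj] at hadj
              obtain ⟨h1, hadj⟩ := hadj
              refine ⟨h1, ?_⟩
              rcases y with _ | _ | k | k
              · rfl
              · exact absurd hadj (hadj_las _)
              · exact absurd hadj (hadj_lala _ _)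
              · rw [hadj_lalb] at hadj
                exact absurd (by rw [hadj, h1]) hv.2
            · rw [hu, dadj] at hadj
              obtain ⟨h1, hadj⟩ := hadj
              rcases y with _ | _ | k | k
              · exact absurd hadj (hadj_lbx _)
              · exact absurd hadj (hadj_lbs _)
              · rw [hadj_lbla] at hadj
                exact absurd (by rw [hadj, h1]) hv.1
              · exact absurd hadj (hadj_lblb _ _)
          obtain ⟨rfl, rfl⟩ := hy
          refine ⟨?_, hx⟩
          intro h hc
          obtain ⟨i', hi'⟩ := hb12 _ _ hc
          have := hκ2 i'
          rw [hi'] at this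
          simp at this)
        ⟨q i, by simp [hqi], _, hq12 i⟩
      rw [hW] at this
      have h1 : (Finset.univ.filter (fun i' => q i' ∈
          ({(g, .la (κ i)), (g, .lb (κ i))} : Finset (Fin m × GadgetV)))) = {i} := by
        ext i'
        simp only [Finset.mem_filter, Finset.mem_univ, true_and, Finset.mem_insert,
          Finset.mem_singleton]
        constructor
        · rintro (h | h)
          · have := hκ2 i'
            rw [h] at this
            simp at this
          · exact hqinj (h.trans hqi.symm)
        · rintro rfl; right; exact hqi
      rw [h1, Finset.sum_singleton] at this
      have h2 : B + 4 ≤ a i + n g := by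
        refine this.trans (Nat.add_le_add_left (Finset.card_le_card ?_) _)
        intro k hk
        simp only [Finset.mem_filter, Finset.mem_insert, Finset.mem_singleton] at hk ⊢
        refine ⟨hk.1, ?_⟩
        rcases hk.2 with h | h <;> rw [h]
      have := ha i
      omega
  have hn : ∀ g, 4 = n g := fun g =>
    (Finset.sum_eq_sum_iff_of_le (s := Finset.univ) (fun g _ => hn4 g)).1
      (by rw [hnsum]; simp [mul_comm]) g (by simp)
  have hAsum : ∑ g : Fin m, B = ∑ g : Fin m, ∑ i ∈ Finset.univ.filter (fun i => f i = g), a i := by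
    rw [Finset.sum_fiberwise, hsum]; simp
  refine ⟨f, hcard3, fun g => ?_⟩
  refine ((Finset.sum_eq_sum_iff_of_le (fun g _ => ?_)).1 hAsum g (by simp)).symm
  have := hAn g
  have := hn g
  omega

theorem statement_7 (m B : ℕ) (hB : 0 < B) (a : Fin (3*m) → ℕ)
    (ha : ∀ i, B < 4 * a i ∧ 2 * a i < B)
    (hsum : ∑ i, a i = m * B) :
    Emptyable (disjointGadgets m) (B+4) (SfullG m a (B+4)) ↔
      ∃ f : Fin (3*m) → Fin m,
        (∀ j : Fin m, (Finset.univ.filter (fun i => f i = j)).card = 3) ∧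
        (∀ j : Fin m, ∑ i ∈ Finset.univ.filter (fun i => f i = j), a i = B) := by
  constructor
  · rintro ⟨p, h1, h2⟩
    rcases Nat.eq_zero_or_pos m with rfl | hm
    · exact ⟨fun i => absurd i.2 (by simp), fun j => j.elim0, fun j => j.elim0⟩
    · obtain ⟨conf, c0, c1, hT⟩ := Traj.of_legal h1 (⟨0, hm⟩, GadgetV.x) (none, 0)
      rw [len_full] at c1 hT
      refine forward_core m B a ha hsum conf _ _ hT ?_ c0 (c1.trans h2)
      intro k hk
      simp [List.getD, get_full _ _ _ _ hk]
  · rintro ⟨f, hf, hs⟩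
    exact backward m B a ha f hf hs

end Hexasort
end

section
/- Let (G, S, t) be a Hexasort instance whose stacks use a finite set C of colors. If G contains a matching of size at least |C| (i.e., |C| pairwise vertex-disjoint edges), then S is fittable on (G, t). -/
open scoped Classical

namespace Hexasort

theorem place_ne {V C : Type*} [Fintype V] (G : SimpleGraph V) (t : ℕ)
    (δ : Config V C) (s : C × ℕ) (x w : V) (h : w ≠ x) :
    place G t δ s x w = none ∨ place G t δ s x w = δ w := by
  unfold place
  rw [if_neg h]
  split_ifs <;> simp

theorem place_self {V C : Type*} [Fintype V] (G : SimpleGraph V) (t : ℕ)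
    (δ : Config V C) (s : C × ℕ) (x : V) (r : C × ℕ)
    (h : place G t δ s x x = some r) : r.1 = s.1 := by
  unfold place at h
  rw [if_pos rfl] at h
  split_ifs at h
  simp only [Option.some.injEq] at h
  rw [← h]

theorem place_adj {V C : Type*} [Fintype V] (G : SimpleGraph V) (t : ℕ)
    (δ : Config V C) (s : C × ℕ) (x y : V) (h : G.Adj x y)
    (hy : ∀ r, δ y = some r → r.1 = s.1) :
    place G t δ s x y = none := by
  unfold place
  rw [if_neg h.ne']
  split_ifs with h1
  · rfl
  · cases hd : δ y with
    | none => rfl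
    | some r =>
      exact absurd ⟨h, r.2, by rw [hd, ← hy r hd]⟩ h1

/-- The invariant: each pair holds only its own color, and one endpoint is empty. -/
def Inv {V C : Type*} (a b : C → V) (δ : Config V C) : Prop :=
  ∀ c, (δ (a c) = none ∨ δ (b c) = none) ∧ (∀ r, δ (a c) = some r → r.1 = c) ∧
    (∀ r, δ (b c) = some r → r.1 = c)

theorem Inv.swap {V C : Type*} {a b : C → V} {δ : Config V C} (h : Inv a b δ) :
    Inv b a δ := fun c => ⟨(h c).1.symm, (h c).2.2, (h c).2.1⟩

theorem Inv.step {V C : Type*} [Fintype V] (G : SimpleGraph V) (t : ℕ)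
    (a b : C → V) (hadj : ∀ c, G.Adj (a c) (b c)) (ha : Function.Injective a)
    (hab : ∀ c d, a c ≠ b d) (δ : Config V C) (h : Inv a b δ) (s : C × ℕ) :
    Inv a b (place G t δ s (a s.1)) := by
  intro c
  obtain ⟨h1, h2, h3⟩ := h c
  have hb := place_ne G t δ s (a s.1) (b c) (hab _ _).symm
  by_cases hc : c = s.1
  · subst hc
    have := place_adj G t δ s (a s.1) (b s.1) (hadj _) h3
    exact ⟨Or.inr this, place_self G t δ s _, by simp [this]⟩
  · have ha' := place_ne G t δ s (a s.1) (a c) (fun e => hc (ha e))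
    refine ⟨?_, ?_, ?_⟩
    · rcases h1 with h1 | h1
      · left; rcases ha' with e | e <;> simp [e, h1]
      · right; rcases hb with e | e <;> simp [e, h1]
    · rcases ha' with e | e
      · simp [e]
      · rwa [e]
    · rcases hb with e | e
      · simp [e]
      · rwa [e]

theorem exists_legal {V C : Type*} [Fintype V] (G : SimpleGraph V) (t : ℕ)
    (a b : C → V) (hadj : ∀ c, G.Adj (a c) (b c)) (ha : Function.Injective a)
    (hb : Function.Injective b) (hab : ∀ c d, a c ≠ b d) (S : List (C × ℕ)) :
    ∀ δ : Config V C, Inv a b δ → ∃ p, Legal G t δ S p := by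
  induction S with
  | nil => exact fun δ _ => ⟨[], .nil δ⟩
  | cons s S ih =>
    intro δ h
    rcases (h s.1).1 with h0 | h0
    · obtain ⟨p, hp⟩ := ih _ (h.step G t a b hadj ha hab δ s)
      exact ⟨_, .cons s S _ p h0 hp⟩
    · obtain ⟨p, hp⟩ := ih _ (h.swap.step G t b a (fun c => (hadj c).symm) hb
        (fun c d => (hab d c).symm) δ s).swap
      exact ⟨_, .cons s S _ p h0 hp⟩

/-- if `G` contains a matching of size at least `|C|`
(here: `|C|` pairwise vertex-disjoint edges `u i – v i`), then `S` is fittable. -/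
theorem statement_10 {V C : Type*} [Fintype V] [Fintype C] (G : SimpleGraph V)
    (t : ℕ) (ht : 1 ≤ t) (S : List (C × ℕ)) (hpos : ∀ s ∈ S, 1 ≤ s.2)
    (u v : Fin (Fintype.card C) → V)
    (hadj : ∀ i, G.Adj (u i) (v i))
    (hdisj : Function.Injective (Sum.elim u v)) :
    Fittable G t S := by
  let e := Fintype.equivFin C
  refine exists_legal G t (fun c => u (e c)) (fun c => v (e c)) (fun c => hadj _) ?_ ?_ ?_ S _ ?_
  · intro c d h
    have := @hdisj (Sum.inl (e c)) (Sum.inl (e d)) h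
    simpa using this
  · intro c d h
    have := @hdisj (Sum.inr (e c)) (Sum.inr (e d)) h
    simpa using this
  · intro c d h
    have := @hdisj (Sum.inl (e c)) (Sum.inr (e d)) h
    simp at this
  · intro c
    simp [emptyConfig]

end Hexasort
end
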